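/- arXiv:2508.01525 — 2 statements merged into one kernel-verified Lean document; each statement's English description precedes it below -/
import Mathlib

section
/- Let A be a finite index set, let P ⊆ A be a nonempty set of positive indices, let s : A → ℝ, let τ > 0, and let ε ≥ 0. Define the per-anchor discriminative loss L = −(1/|P|) Σ_{p ∈ P} log( exp(s_p/τ) / Σ_{j ∈ A} exp(s_j/τ) ). If L ≤ ε, then: (i) for every p ∈ P the softmax ratio satisfies exp(s_p/τ) / Σ_{j ∈ A} exp(s_j/τ) ≥ exp(−|P| ε); and (ii) for every p ∈ P and every j ∈ A, s_j ≤ s_p + τ · |P| · ε. -/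
open Real

/-- **Small discriminative loss forces dominant positive similarities.**
For a finite index set `A`, a nonempty set of positives `P ⊆ A`, similarities
`s : A → ℝ`, temperature `τ > 0` and `ε ≥ 0`: if the per-anchor discriminative loss
`L = −(1/|P|) ∑_{p ∈ P} log(exp(s p / τ) / ∑_{j ∈ A} exp(s j / τ))` satisfies `L ≤ ε`,
then (i) every positive softmax ratio is at least `exp(−|P| ε)`, and
(ii) `s j ≤ s p + τ |P| ε` for every `p ∈ P` and `j ∈ A`. -/
theorem discriminative_loss_small_implies_dominance
    {ι : Type*} (A P : Finset ι) (hPA : P ⊆ A) (hP : P.Nonempty)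
    (s : ι → ℝ) (τ : ℝ) (hτ : 0 < τ) (ε : ℝ) (hε : 0 ≤ ε)
    (hL : -(1 / (P.card : ℝ)) *
        ∑ p ∈ P, Real.log (Real.exp (s p / τ) / ∑ j ∈ A, Real.exp (s j / τ)) ≤ ε) :
    (∀ p ∈ P,
      Real.exp (-(P.card : ℝ) * ε) ≤
        Real.exp (s p / τ) / ∑ j ∈ A, Real.exp (s j / τ)) ∧
    (∀ p ∈ P, ∀ j ∈ A, s j ≤ s p + τ * (P.card : ℝ) * ε) := by
  have hle : ∀ j ∈ A, exp (s j / τ) ≤ ∑ k ∈ A, exp (s k / τ) := fun j hj =>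
    Finset.single_le_sum (f := fun k => exp (s k / τ)) (fun k _ => (exp_pos _).le) hj
  obtain ⟨q, hq⟩ := hP
  have hZ : 0 < ∑ k ∈ A, exp (s k / τ) := (exp_pos _).trans_le (hle q (hPA hq))
  have hcard : (0 : ℝ) < P.card := by exact_mod_cast Finset.card_pos.mpr ⟨q, hq⟩
  have hsum : -((P.card : ℝ) * ε) ≤
      ∑ p ∈ P, log (exp (s p / τ) / ∑ k ∈ A, exp (s k / τ)) := by
    rw [neg_mul, one_div_mul_eq_div, ← neg_div, div_le_iff₀ hcard] at hL
    linarith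
  have hratio : ∀ p ∈ P, exp (-(P.card : ℝ) * ε) ≤
      exp (s p / τ) / ∑ k ∈ A, exp (s k / τ) := by
    intro p hp
    rw [← le_log_iff_exp_le (div_pos (exp_pos _) hZ), neg_mul]
    have hothers : ∑ r ∈ P, -log (exp (s r / τ) / ∑ k ∈ A, exp (s k / τ)) ≥
        -log (exp (s p / τ) / ∑ k ∈ A, exp (s k / τ)) :=
      Finset.single_le_sum (f := fun r => -log (exp (s r / τ) / ∑ k ∈ A, exp (s k / τ)))
        (fun r hr => neg_nonneg.mpr <| log_nonpos (div_pos (exp_pos _) hZ).le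
          ((div_le_one hZ).mpr (hle r (hPA hr)))) hp
    rw [Finset.sum_neg_distrib] at hothers
    linarith
  refine ⟨hratio, fun p hp j hj => ?_⟩
  have hexp : exp (-(P.card : ℝ) * ε + s j / τ) ≤ exp (s p / τ) := by
    rw [exp_add]
    exact (mul_le_mul_of_nonneg_left (hle j hj) (exp_pos _).le).trans
      ((le_div_iff₀ hZ).mp (hratio p hp))
  have hdiv : s j / τ ≤ s p / τ + P.card * ε := by linarith [exp_le_exp.mp hexp]
  calc s j = s j / τ * τ := (div_mul_cancel₀ _ hτ.ne').symm
    _ ≤ (s p / τ + P.card * ε) * τ := mul_le_mul_of_nonneg_right hdiv hτ.le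
    _ = s p + τ * P.card * ε := by field_simp
end

section
/- Let A be a finite index set, let P ⊆ A with p ∈ P, let N = A \ P be the set of negative indices, let s : A → ℝ, τ > 0 and δ ≥ 0. Suppose the margin conditions hold: s_q ≤ s_p for all q ∈ P, and s_n ≤ s_p − δ for all n ∈ N. Then the softmax probability of the positive pair satisfies exp(s_p/τ) / Σ_{j ∈ A} exp(s_j/τ) ≥ 1 / ( |P| + |N| · exp(−δ/τ) ), and consequently the per-pair loss satisfies −log( exp(s_p/τ) / Σ_{j ∈ A} exp(s_j/τ) ) ≤ log( |P| + |N| · exp(−δ/τ) ). -/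
open Real

/-- **Margin-based bound on the per-pair supervised contrastive loss.**
For a finite index set `A`, positives `P ⊆ A` with `p ∈ P`, negatives `N = A \ P`,
similarities `s : A → ℝ`, temperature `τ > 0` and margin `δ ≥ 0`: if `s q ≤ s p` for
all `q ∈ P` and `s n ≤ s p − δ` for all `n ∈ N`, then the positive softmax ratio is
at least `1 / (|P| + |N| exp(−δ/τ))`, and consequently the per-pair loss is at most
`log(|P| + |N| exp(−δ/τ))`. -/
theorem margin_bound_contrastive_loss
    {ι : Type*} [DecidableEq ι] (A P : Finset ι) (hPA : P ⊆ A) (p : ι) (hp : p ∈ P)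
    (s : ι → ℝ) (τ : ℝ) (hτ : 0 < τ) (δ : ℝ) (hδ : 0 ≤ δ)
    (hpos : ∀ q ∈ P, s q ≤ s p)
    (hneg : ∀ n ∈ A \ P, s n ≤ s p - δ) :
    1 / ((P.card : ℝ) + ((A \ P).card : ℝ) * Real.exp (-δ / τ)) ≤
      Real.exp (s p / τ) / ∑ j ∈ A, Real.exp (s j / τ) ∧
    -Real.log (Real.exp (s p / τ) / ∑ j ∈ A, Real.exp (s j / τ)) ≤
      Real.log ((P.card : ℝ) + ((A \ P).card : ℝ) * Real.exp (-δ / τ)) := by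
  have hP : ∑ j ∈ P, Real.exp (s j / τ) ≤ P.card * Real.exp (s p / τ) := by
    rw [← nsmul_eq_mul]
    refine Finset.sum_le_card_nsmul _ _ _ fun q hq => ?_
    have := hpos q hq
    gcongr
  have hN : ∑ j ∈ A \ P, Real.exp (s j / τ) ≤
      (A \ P).card * (Real.exp (-δ / τ) * Real.exp (s p / τ)) := by
    rw [← nsmul_eq_mul, ← Real.exp_add, ← add_div, neg_add_eq_sub]
    refine Finset.sum_le_card_nsmul _ _ _ fun n hn => ?_
    have := hneg n hn
    gcongr
  have hsum : ∑ j ∈ A, Real.exp (s j / τ) ≤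
      Real.exp (s p / τ) * (P.card + (A \ P).card * Real.exp (-δ / τ)) := by
    rw [← Finset.sum_sdiff hPA]
    linarith
  have hcard : (0 : ℝ) < P.card := by exact_mod_cast Finset.card_pos.mpr ⟨p, hp⟩
  have hD : 0 < (P.card : ℝ) + (A \ P).card * Real.exp (-δ / τ) := by positivity
  have hS : 0 < ∑ j ∈ A, Real.exp (s j / τ) :=
    Finset.sum_pos (fun _ _ => Real.exp_pos _) ⟨p, hPA hp⟩
  have hratio : 1 / ((P.card : ℝ) + (A \ P).card * Real.exp (-δ / τ)) ≤
      Real.exp (s p / τ) / ∑ j ∈ A, Real.exp (s j / τ) := by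
    rwa [div_le_div_iff₀ hD hS, one_mul]
  refine ⟨hratio, ?_⟩
  have hlog := Real.log_le_log (one_div_pos.mpr hD) hratio
  rw [one_div, Real.log_inv] at hlog
  linarith
end
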